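/- Let Λ = KQ*/⟨R*⟩ be a complete gentle algebra, d a dimension vector, and r = (r_a)_{a∈Q*_1} a rank sequence for d. Then dim rep(Λ,d,r) ≤ Σ_{i∈Q*_0} d(i)² = dim GL(d). -/

import Mathlib

/-! Framework: gentle and complete gentle quivers with relations.  Since all relations
of a gentle quiver are monomial of length two, the relation set is recorded as a set of
composable pairs of arrows: the pair `(a, b)` stands for the length-two path `a` then
`b` (written `ba` in the composition conventions of the paper). -/

/-- A finite quiver: finite vertex and arrow sets with source and target maps. -/
structure QuiverData where
  V : Type
  A : Type
  [fintypeV : Fintype V]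
  [fintypeA : Fintype A]
  [decEqV : DecidableEq V]
  [decEqA : DecidableEq A]
  src : A → V
  tgt : A → V

attribute [instance] QuiverData.fintypeV QuiverData.fintypeA QuiverData.decEqV QuiverData.decEqA

/-- The pairs of arrows `(a, b)` such that the path `a` then `b` makes sense. -/
def ComposablePairs (Q : QuiverData) : Set (Q.A × Q.A) :=
  { p | Q.tgt p.1 = Q.src p.2 }

/-- (SB1): every vertex has at most two incoming and at most two outgoing arrows. -/
def SB1 (Q : QuiverData) : Prop :=
  ∀ v : Q.V, Fintype.card {a : Q.A // Q.tgt a = v} ≤ 2 ∧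
    Fintype.card {a : Q.A // Q.src a = v} ≤ 2

/-- (SB2) for monomial length-two relations: for every arrow `a` there is at most one
arrow `b` such that `a` then `b` avoids the relations, and at most one arrow `c` such
that `c` then `a` avoids the relations. -/
def SB2 (Q : QuiverData) (R : Set (Q.A × Q.A)) : Prop :=
  ∀ a : Q.A,
    {b : Q.A | Q.tgt a = Q.src b ∧ (a, b) ∉ R}.Subsingleton ∧
    {c : Q.A | Q.tgt c = Q.src a ∧ (c, a) ∉ R}.Subsingleton

/-- (G1): if `a₁ ≠ a₂` are arrows with the same tail and `b` is an arrow with head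
that tail, then exactly one of the paths `b`-then-`a₁`, `b`-then-`a₂` is a relation. -/
def G1 (Q : QuiverData) (R : Set (Q.A × Q.A)) : Prop :=
  ∀ a₁ a₂ b : Q.A, a₁ ≠ a₂ → Q.src a₁ = Q.src a₂ → Q.tgt b = Q.src a₁ →
    ((b, a₁) ∈ R ↔ (b, a₂) ∉ R)

/-- (G2): if `b₁ ≠ b₂` are arrows with the same head and `a` is an arrow with tail
that head, then exactly one of the paths `b₁`-then-`a`, `b₂`-then-`a` is a relation. -/
def G2 (Q : QuiverData) (R : Set (Q.A × Q.A)) : Prop :=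
  ∀ b₁ b₂ a : Q.A, b₁ ≠ b₂ → Q.tgt b₁ = Q.tgt b₂ → Q.src a = Q.tgt b₁ →
    ((b₁, a) ∈ R ↔ (b₂, a) ∉ R)

/-- A gentle quiver with relations: (SB1), (SB2), (G1), (G2) hold and all relations
are (composable) length-two monomial relations (G3). -/
def IsGentle (Q : QuiverData) (R : Set (Q.A × Q.A)) : Prop :=
  R ⊆ ComposablePairs Q ∧ SB1 Q ∧ SB2 Q R ∧ G1 Q R ∧ G2 Q R

/-- A complete gentle quiver with relations: every vertex has exactly two incoming and
exactly two outgoing arrows, and every arrow `a` has exactly one arrow `a'` with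
`a`-then-`a'` a relation and exactly one arrow `a''` with `a''`-then-`a` a relation. -/
def IsCompleteGentle (Q : QuiverData) (R : Set (Q.A × Q.A)) : Prop :=
  R ⊆ ComposablePairs Q ∧
    (∀ v : Q.V, Fintype.card {a : Q.A // Q.tgt a = v} = 2 ∧
      Fintype.card {a : Q.A // Q.src a = v} = 2) ∧
    (∀ a : Q.A, ∃! a' : Q.A, (a, a') ∈ R) ∧
    (∀ a : Q.A, ∃! a'' : Q.A, (a'', a) ∈ R)

/-- The affine space of `d`-dimensional representations of the quiver `Q` (with chosen
bases): a matrix `Mat_{d(ta) × d(sa)}(K)` for each arrow `a`. -/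
abbrev RepSpace (K : Type) [Field K] (Q : QuiverData) (d : Q.V → ℕ) : Type :=
  ∀ a : Q.A, Matrix (Fin (d (Q.tgt a))) (Fin (d (Q.src a))) K

/-- Casting matrices along equalities of dimensions. -/
def castMat {K : Type} [Field K] {m n m' n' : ℕ} (h1 : m = m') (h2 : n = n')
    (M : Matrix (Fin m) (Fin n) K) : Matrix (Fin m') (Fin n') K :=
  M.submatrix (Fin.cast h1.symm) (Fin.cast h2.symm)

/-- The representation variety `rep(Λ, d)` of the algebra `Λ = KQ/⟨R⟩` presented by a
quiver with length-two monomial relations `R`: representations `M` with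
`M(b) M(a) = 0` for every relation `a`-then-`b` in `R`. -/
def RepSet (K : Type) [Field K] (Q : QuiverData) (R : Set (Q.A × Q.A)) (d : Q.V → ℕ) :
    Set (RepSpace K Q d) :=
  { M | ∀ p : Q.A × Q.A, p ∈ R → ∀ h : Q.tgt p.1 = Q.src p.2,
      castMat rfl (congrArg d h.symm) (M p.2) * M p.1 = 0 }

/-- The base change group `GL(d) = ∏_v GL(d(v), K)`. -/
abbrev GLd (K : Type) [Field K] (Q : QuiverData) (d : Q.V → ℕ) : Type :=
  ∀ v : Q.V, GL (Fin (d v)) K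

/-- The base change action of `GL(d)` on the representation space. -/
def glAct {K : Type} [Field K] {Q : QuiverData} {d : Q.V → ℕ}
    (g : GLd K Q d) (M : RepSpace K Q d) : RepSpace K Q d :=
  fun a => (g (Q.tgt a) : Matrix (Fin (d (Q.tgt a))) (Fin (d (Q.tgt a))) K) * M a *
    (((g (Q.src a))⁻¹ : GL (Fin (d (Q.src a))) K) :
      Matrix (Fin (d (Q.src a))) (Fin (d (Q.src a))) K)

/-- An effective oriented cycle of `(Q, R)`: pairwise distinct arrows
`c_0, c_1, …, c_{m-1}` forming an oriented cycle all of whose consecutive length-two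
subpaths (including the wrap-around one) are relations in `R`. -/
def IsEffectiveCycle (Q : QuiverData) (R : Set (Q.A × Q.A)) {m : ℕ}
    (c : ZMod m → Q.A) : Prop :=
  0 < m ∧ Function.Injective c ∧
    ∀ i : ZMod m, Q.tgt (c i) = Q.src (c (i + 1)) ∧ (c i, c (i + 1)) ∈ R

/-- The space in which circular complexes live. -/
abbrev CompSpace (K : Type) [Field K] {l : ℕ} (n : ZMod l → ℕ) : Type :=
  ∀ i : ZMod l, Matrix (Fin (n (i + 1))) (Fin (n i)) K

/-- The variety of circular complexes. -/
def Comp (K : Type) [Field K] {l : ℕ} (n : ZMod l → ℕ) : Set (CompSpace K n) :=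
  { A | ∀ i : ZMod l, A (i + 1) * A i = 0 }

open MvPolynomial in
/-- The Zariski topology on the affine space `ι → K`. -/
def zariskiTopology (ι K : Type) [CommSemiring K] : TopologicalSpace (ι → K) :=
  .generateFrom { U | ∃ p : MvPolynomial ι K, U = { x | eval x p ≠ 0 } }

/-- Coordinates on `RepSpace K Q d`. -/
def repCoord {K : Type} [Field K] (Q : QuiverData) (d : Q.V → ℕ) :
    RepSpace K Q d → ((Σ a : Q.A, Fin (d (Q.tgt a)) × Fin (d (Q.src a))) → K) :=
  fun M q => M q.1 q.2.1 q.2.2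

/-- The Zariski topology on `RepSpace K Q d`. -/
def repTopology (K : Type) [Field K] (Q : QuiverData) (d : Q.V → ℕ) :
    TopologicalSpace (RepSpace K Q d) :=
  (zariskiTopology _ K).induced (repCoord Q d)

/-- `r` is a rank sequence for `d`: it is realized by some representation in
`rep(Λ,d)`. -/
def IsRankSeq (K : Type) [Field K] (Q : QuiverData) (R : Set (Q.A × Q.A))
    (d : Q.V → ℕ) (r : Q.A → ℕ) : Prop :=
  ∃ M ∈ RepSet K Q R d, ∀ a : Q.A, (M a).rank = r a

/-- `rep(Λ,d,r)`: the representations in `rep(Λ,d)` with `rank M(a) ≤ r_a` for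
every arrow `a`. -/
def RepSetR (K : Type) [Field K] (Q : QuiverData) (R : Set (Q.A × Q.A))
    (d : Q.V → ℕ) (r : Q.A → ℕ) : Set (RepSpace K Q d) :=
  { M ∈ RepSet K Q R d | ∀ a : Q.A, (M a).rank ≤ r a }

section Dimension

open Cardinal Algebra in
/-- A finitely generated algebra over a field that embeds in an algebra generated by finitely many
elements has Krull dimension at most the number of these generators. -/
theorem ringKrullDim_le_card_of_range_le_adjoin {K A F T : Type} [Field K] [CommRing A]
    [Nontrivial A] [Algebra K A] [Algebra.FiniteType K A] [CommRing F] [Algebra K F]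
    [Fintype T] (f : A →ₐ[K] F) (hf : Function.Injective f) (s : T → F)
    (hs : f.range ≤ Algebra.adjoin K (Set.range s)) :
    ringKrullDim A ≤ (Fintype.card T : ℕ) := by
  obtain ⟨n, g, hg, hint⟩ := exists_integral_inj_algHom_of_fg K A
  algebraize [g.toRingHom]
  have h1 : ringKrullDim A ≤ ringKrullDim (MvPolynomial (Fin n) K) :=
    Order.krullDim_le_of_strictMono
      (PrimeSpectrum.comap (algebraMap (MvPolynomial (Fin n) K) A))
      (fun I J hIJ => Ideal.IsIntegral.comap_lt_comap (R := MvPolynomial (Fin n) K) (A := A) hIJ)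
  refine h1.trans ?_
  rw [MvPolynomial.ringKrullDim_of_isNoetherianRing, ringKrullDim_eq_zero_of_field, zero_add,
    Nat.card_fin]
  suffices (n : Cardinal) ≤ (Fintype.card T : ℕ) by exact_mod_cast this
  have h2 : (n : Cardinal) = Algebra.trdeg K (MvPolynomial (Fin n) K) := by
    rw [MvPolynomial.trdeg_of_isDomain]; simp
  have h3 : ((Fintype.card T : ℕ) : Cardinal) = Algebra.trdeg K (MvPolynomial T K) := by
    rw [MvPolynomial.trdeg_of_isDomain]; simp
  rw [h2, h3]
  have hmem : ∀ x, (f.comp g) x ∈ (MvPolynomial.aeval s : MvPolynomial T K →ₐ[K] F).range := by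
    intro x
    rw [← Algebra.adjoin_range_eq_range_aeval]
    exact hs ⟨g x, rfl⟩
  refine (trdeg_le_of_injective ((f.comp g).codRestrict _ hmem) ?_).trans
    (trdeg_le_of_surjective (MvPolynomial.aeval s : MvPolynomial T K →ₐ[K] F).rangeRestrict
      (AlgHom.rangeRestrict_surjective _))
  exact (AlgHom.injective_codRestrict _ _ _).2 (hf.comp hg)

theorem exists_eval_ne_zero_of_isOpen_zariskiTopology {ι K : Type} [Field K] {U : Set (ι → K)}
    (hU : @IsOpen _ (zariskiTopology ι K) U) {x : ι → K} (hx : x ∈ U) :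
    ∃ p : MvPolynomial ι K, MvPolynomial.eval x p ≠ 0 ∧
      ∀ y, MvPolynomial.eval y p ≠ 0 → y ∈ U := by
  induction hU with
  | basic U h =>
    obtain ⟨p, rfl⟩ := h
    exact ⟨p, hx, fun y hy => hy⟩
  | univ => exact ⟨1, by simp, fun _ _ => trivial⟩
  | inter U V _ _ hU hV =>
    obtain ⟨p, hp, hpU⟩ := hU hx.1
    obtain ⟨q, hq, hqV⟩ := hV hx.2
    refine ⟨p * q, by simp [hp, hq], fun y hy => ?_⟩
    rw [map_mul] at hy
    exact ⟨hpU y (left_ne_zero_of_mul hy), hqV y (right_ne_zero_of_mul hy)⟩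
  | sUnion S _ h =>
    obtain ⟨U, hUS, hxU⟩ := hx
    obtain ⟨p, hp, hpU⟩ := h U hUS hxU
    exact ⟨p, hp, fun y hy => ⟨U, hUS, hpU y hy⟩⟩

/-- A space with the topology induced from the Zariski topology on an affine space has dimension
at most the supremum of the dimensions of the coordinate rings of irreducible closed subsets. -/
theorem topologicalKrullDim_le_of_ringKrullDim_quotient_le {ι K T : Type} [Field K]
    [t : TopologicalSpace T] (c : T → ι → K) (ht : t = (zariskiTopology ι K).induced c)
    (N : WithBot ℕ∞)
    (H : ∀ P : Ideal (MvPolynomial ι K), P.IsPrime →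
      (∀ p, (∀ x, MvPolynomial.eval (c x) p = 0) → p ∈ P) →
      ringKrullDim (MvPolynomial ι K ⧸ P) ≤ N) :
    topologicalKrullDim T ≤ N := by
  have hopen : ∀ U : Set T, IsOpen U ↔
      ∃ V, @IsOpen _ (zariskiTopology ι K) V ∧ c ⁻¹' V = U := by
    subst ht
    exact fun U => @isOpen_induced_iff _ _ (zariskiTopology ι K) _ _
  have hcl : ∀ p : MvPolynomial ι K, IsClosed {x | MvPolynomial.eval (c x) p = 0} := by
    intro p
    rw [← isOpen_compl_iff, hopen]
    exact ⟨_, .basic _ ⟨p, rfl⟩, rfl⟩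
  let I : TopologicalSpace.IrreducibleCloseds T → Ideal (MvPolynomial ι K) := fun Z =>
    { carrier := {p | ∀ x ∈ Z, MvPolynomial.eval (c x) p = 0}
      add_mem' := fun hp hq x hx => by simp [hp x hx, hq x hx]
      zero_mem' := fun x _ => by simp
      smul_mem' := fun a p hp x hx => by simp [hp x hx] }
  have hprime : ∀ Z, (I Z).IsPrime := by
    intro Z
    refine ⟨?_, ?_⟩
    · rw [Ideal.ne_top_iff_one]
      intro h
      obtain ⟨x, hx⟩ := Z.isIrreducible'.1
      simpa using h x hx
    · intro p q hpq
      have := isPreirreducible_iff_isClosed_union_isClosed.1 Z.isIrreducible'.2 _ _ (hcl p) (hcl q)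
        (fun x hx => by simpa using hpq x hx)
      exact this
  have hanti : ∀ Z Z', Z < Z' → I Z' < I Z := by
    intro Z Z' hlt
    refine lt_of_le_not_ge (fun p hp x hx => hp x (hlt.le hx)) fun hle => hlt.not_ge ?_
    intro x hx
    by_contra hxZ
    obtain ⟨U, hU, hUZ⟩ := (hopen (Z : Set T)ᶜ).1 Z.isClosed'.isOpen_compl
    have hxU : c x ∈ U := by
      have : x ∈ c ⁻¹' U := by rw [hUZ]; exact hxZ
      exact this
    obtain ⟨p, hp, hpU⟩ := exists_eval_ne_zero_of_isOpen_zariskiTopology hU hxU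
    refine hp (hle (x := p) (fun y hy => ?_) x hx)
    by_contra hne
    have : y ∈ c ⁻¹' U := hpU _ hne
    rw [hUZ] at this
    exact this hy
  rw [topologicalKrullDim, Order.krullDim]
  refine iSup_le fun C => ?_
  refine le_trans ?_ (H (I C.last) (hprime _) fun p hp x _ => hp x)
  rw [ringKrullDim_quotient, ← Order.krullDim_orderDual]
  let D : LTSeries (PrimeSpectrum.zeroLocus (I C.last : Set (MvPolynomial ι K)))ᵒᵈ :=
    { length := C.length
      toFun := fun i => OrderDual.toDual ⟨⟨I (C i), hprime _⟩, by
        have hle : C i ≤ C.last := C.monotone (Fin.le_last i)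
        exact fun p hp x hx => hp x (hle hx)⟩
      step := fun i => hanti _ _ (C.step i) }
  exact le_iSup (fun E : LTSeries
    (PrimeSpectrum.zeroLocus (I C.last : Set (MvPolynomial ι K)))ᵒᵈ => (E.length : WithBot ℕ∞)) D

end Dimension

section Generation

/-- Every matrix over a field has a set of linearly independent rows spanning all rows. -/
theorem Matrix.exists_row_basis {m n F : Type} [Fintype m] [Field F]
    (M : Matrix m n F) :
    ∃ (p : Finset m) (X : m → m → F),
      (∀ c : m → F, (∀ k, ∑ i ∈ p, c i * M i k = 0) → ∀ i ∈ p, c i = 0) ∧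
      (∀ q k, M q k = ∑ i ∈ p, X q i * M i k) := by
  classical
  obtain ⟨b, -, -, hspan, hli⟩ := exists_linearIndepOn_extension (K := F) (v := M.row)
    (linearIndepOn_empty F M.row) (Set.subset_univ ∅)
  lift b to Finset m using b.toFinite
  have hX : ∀ q, ∃ x : m → F, ∑ i ∈ b, x i • M.row i = M.row q := fun q =>
    Submodule.mem_span_image_finset_iff_exists_fun' F |>.1 (hspan ⟨q, trivial, rfl⟩)
  choose X hX using hX
  refine ⟨b, X, fun c hc => ?_, fun q k => ?_⟩
  · refine linearIndepOn_finset_iff.1 hli c ?_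
    ext k
    simpa [Finset.sum_apply] using hc k
  · simpa [Finset.sum_apply] using (congrFun (hX q) k).symm

/-- Over a field, the entries of matrices `M a` with `M (σ a) * M a = 0` for a permutation `σ` lie
in a subalgebra generated by at most half the sum of the squared sizes of the matrices. -/
theorem exists_generators_of_circular_complex {K F A : Type} [Field K] [Field F] [Algebra K F]
    [Fintype A] (σ : Equiv.Perm A) {m n : A → Type} [∀ a, Fintype (m a)]
    (e : ∀ a, m a ≃ n (σ a)) (M : ∀ a, Matrix (m a) (n a) F)
    (hM : ∀ a i k, ∑ j, M (σ a) i (e a j) * M a j k = 0) :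
    ∃ (T : Type) (_ : Fintype T) (s : T → F),
      2 * Fintype.card T ≤ ∑ a, Fintype.card (m a) ^ 2 ∧
      ∀ a i k, M a i k ∈ Algebra.adjoin K (Set.range s) := by
  classical
  choose p X hli hX using fun a => (M a).exists_row_basis
  have hδ : ∀ a, ∀ q ∈ p a, ∀ i ∈ p a, X a q i = if q = i then 1 else 0 := by
    intro a q hq i hi
    have := hli a (fun i => X a q i - if q = i then 1 else 0) (fun k => ?_) i hi
    · exact sub_eq_zero.1 this
    · simp only [sub_mul, Finset.sum_sub_distrib, ← hX a q k]
      simp [hq]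
  have hkill : ∀ a i, ∀ j ∈ p a, ∑ q, M (σ a) i (e a q) * X a q j = 0 := by
    intro a i
    refine hli a _ fun k => ?_
    rw [← hM a i k]
    simp_rw [Finset.sum_mul]
    rw [Finset.sum_comm]
    refine Finset.sum_congr rfl fun q _ => ?_
    rw [hX a q k, Finset.mul_sum]
    exact Finset.sum_congr rfl fun j _ => mul_assoc _ _ _
  let T := Σ a, (↥(p a)ᶜ × ↥(p a)) ⊕ (↥(p (σ a)) × ↥(p a)ᶜ)
  let s : T → F := fun t => Sum.elim (fun u => X t.1 u.1 u.2)
    (fun u => M (σ t.1) u.1 (e t.1 u.2)) t.2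
  refine ⟨T, inferInstance, s, ?_, ?_⟩
  · have hcard : Fintype.card T =
        ∑ a, ((p a)ᶜ.card * (p a).card + (p (σ a)).card * (p a)ᶜ.card) := by
      simp only [T, Fintype.card_sigma, Fintype.card_sum, Fintype.card_prod, Fintype.card_coe]
    have hσ : ∑ a, (p (σ a)).card ^ 2 = ∑ a, (p a).card ^ 2 :=
      Equiv.sum_comp σ fun a => (p a).card ^ 2
    have hle : ∑ a, (2 * ((p a)ᶜ.card * (p a).card + (p (σ a)).card * (p a)ᶜ.card)
        + (p a).card ^ 2) ≤ ∑ a, (Fintype.card (m a) ^ 2 + (p (σ a)).card ^ 2) := by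
      refine Finset.sum_le_sum fun a _ => ?_
      rw [← Finset.card_add_card_compl (p a)]
      zify
      nlinarith [sq_nonneg (((p a)ᶜ.card : ℤ) - (p (σ a)).card)]
    rw [Finset.sum_add_distrib, Finset.sum_add_distrib, hσ, ← Finset.mul_sum] at hle
    rw [hcard]
    exact Nat.le_of_add_le_add_right hle
  · set B := Algebra.adjoin K (Set.range s)
    have hXB : ∀ a q, ∀ i ∈ p a, X a q i ∈ B := by
      intro a q i hi
      by_cases hq : q ∈ p a
      · rw [hδ a q hq i hi]
        split_ifs
        exacts [one_mem _, zero_mem _]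
      · exact Algebra.subset_adjoin
          ⟨⟨a, Sum.inl (⟨q, Finset.mem_compl.2 hq⟩, ⟨i, hi⟩)⟩, rfl⟩
    have hcompl : ∀ a, ∀ i ∈ p (σ a), ∀ q ∉ p a, M (σ a) i (e a q) ∈ B := fun a i hi q hq =>
      Algebra.subset_adjoin ⟨⟨a, Sum.inr (⟨i, hi⟩, ⟨q, Finset.mem_compl.2 hq⟩)⟩, rfl⟩
    have hrow : ∀ a, ∀ i ∈ p (σ a), ∀ j, M (σ a) i (e a j) ∈ B := by
      intro a i hi j
      by_cases hj : j ∈ p a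
      · have h := hkill a i j hj
        rw [← Finset.sum_add_sum_compl (p a), Finset.sum_congr rfl
          (fun q hq => by rw [hδ a q hq j hj])] at h
        simp only [mul_ite, mul_one, mul_zero, Finset.sum_ite_eq', hj, if_true] at h
        rw [eq_neg_of_add_eq_zero_left h]
        exact neg_mem (sum_mem fun q hq => mul_mem
          (hcompl a i hi q (Finset.mem_compl.1 hq)) (hXB a q j hj))
      · exact hcompl a i hi j hj
    intro a i k
    obtain ⟨b, rfl⟩ := σ.surjective a
    obtain ⟨j, rfl⟩ := (e b).surjective k
    rw [hX]
    exact sum_mem fun i' hi' => mul_mem (hXB _ _ _ hi') (hrow b i' hi' j)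

end Generation

/-- In a complete gentle quiver the relations form the graph of a permutation of the arrows. -/
theorem IsCompleteGentle.exists_perm {Q : QuiverData} {R : Set (Q.A × Q.A)}
    (h : IsCompleteGentle Q R) : ∃ σ : Equiv.Perm Q.A, ∀ a, (a, σ a) ∈ R := by
  obtain ⟨-, -, h1, h2⟩ := h
  choose f hf hu using h1
  refine ⟨Equiv.ofBijective f ⟨fun a b hab => ?_, fun b => ?_⟩, hf⟩
  · exact (h2 (f a)).unique (hf a) (hab ▸ hf b)
  · obtain ⟨a, ha, -⟩ := h2 b
    exact ⟨a, (hu a b ha).symm⟩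

theorem IsCompleteGentle.sum_sq_tgt {Q : QuiverData} {R : Set (Q.A × Q.A)}
    (h : IsCompleteGentle Q R) (d : Q.V → ℕ) :
    ∑ a, d (Q.tgt a) ^ 2 = 2 * ∑ v, d v ^ 2 := by
  rw [← Finset.sum_fiberwise (s := Finset.univ) Q.tgt, Finset.mul_sum]
  refine Finset.sum_congr rfl fun v _ => ?_
  rw [Finset.sum_congr rfl (fun a ha => by rw [(Finset.mem_filter.1 ha).2]), Finset.sum_const,
    ← Fintype.card_subtype, (h.2.1 v).1, smul_eq_mul]

/-- **Statement 13.** Let `Λ = KQ*/⟨R*⟩` be a complete gentle algebra, `d` a dimension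
vector and `r` a rank sequence for `d`.  Then
`dim rep(Λ,d,r) ≤ ∑_{i ∈ Q*₀} d(i)² (= dim GL(d))`, where the dimension is the
topological Krull dimension for the Zariski topology. -/
theorem dim_repSetR_le (K : Type) [Field K] [IsAlgClosed K] [CharZero K]
    (Q : QuiverData) (R : Set (Q.A × Q.A)) (hcg : IsCompleteGentle Q R)
    (d : Q.V → ℕ) (r : Q.A → ℕ) (hr : IsRankSeq K Q R d r) :
    letI := repTopology K Q d
    topologicalKrullDim (RepSetR K Q R d r) ≤
      ((∑ v : Q.V, (d v) ^ 2 : ℕ) : WithBot ℕ∞) := by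
  let ι := Σ a : Q.A, Fin (d (Q.tgt a)) × Fin (d (Q.src a))
  let := repTopology K Q d
  refine topologicalKrullDim_le_of_ringKrullDim_quotient_le (ι := ι) (K := K)
    (fun M : RepSetR K Q R d r => repCoord Q d M.1) (@induced_compose _ _ _ (zariskiTopology ι K) _ _) _ ?_
  intro P hP hvanish
  obtain ⟨σ, hσ⟩ := hcg.exists_perm
  have htgt : ∀ a, Q.tgt a = Q.src (σ a) := fun a => hcg.1 (hσ a)
  let f : (MvPolynomial ι K ⧸ P) →ₐ[K] FractionRing (MvPolynomial ι K ⧸ P) :=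
    IsScalarTower.toAlgHom _ _ _
  let x : ι → FractionRing (MvPolynomial ι K ⧸ P) := fun i =>
    f (Ideal.Quotient.mkₐ K P (MvPolynomial.X i))
  obtain ⟨T, _, s, hcard, hs⟩ := exists_generators_of_circular_complex (K := K) σ
    (m := fun a => Fin (d (Q.tgt a))) (n := fun a => Fin (d (Q.src a)))
    (fun a => finCongr (congrArg d (htgt a))) (fun a i j => x ⟨a, i, j⟩) (by
      intro a i k
      have hp : ∑ j, MvPolynomial.X (R := K) (σ := ι)
          ⟨σ a, i, finCongr (congrArg d (htgt a)) j⟩ * MvPolynomial.X ⟨a, j, k⟩ ∈ P := by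
        refine hvanish _ fun M => ?_
        have := congrFun (congrFun (M.2.1 _ (hσ a) (htgt a)) i) k
        simpa [Matrix.mul_apply, castMat, repCoord] using this
      have h0 := congrArg f (Ideal.Quotient.eq_zero_iff_mem.2 hp)
      simpa [x] using h0)
  refine (ringKrullDim_le_card_of_range_le_adjoin f (IsFractionRing.injective _ _) s ?_).trans ?_
  · rintro _ ⟨y, rfl⟩
    obtain ⟨q, rfl⟩ := Ideal.Quotient.mkₐ_surjective K P y
    change (f.comp (Ideal.Quotient.mkₐ K P)) q ∈ _
    induction q using MvPolynomial.induction_on with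
    | C c => exact (AlgHom.commutes (f.comp (Ideal.Quotient.mkₐ K P)) c).symm ▸
        Subalgebra.algebraMap_mem _ c
    | add p q hp hq => rw [map_add]; exact add_mem hp hq
    | mul_X p i hp => rw [map_mul]; exact mul_mem hp (hs i.1 i.2.1 i.2.2)
  · simp only [Fintype.card_fin, hcg.sum_sq_tgt] at hcard
    exact_mod_cast Nat.le_of_mul_le_mul_left hcard two_pos
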